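/- arXiv:1202.1931 — 3 statements merged into one kernel-verified Lean document; each statement's English description precedes it below -/
import Mathlib

section
/- Let a > 0, c < 0, k ∈ ℝ, and let q : (0,∞) → ℝ be measurable with q(r) = 0 for all r ≥ a and with r ↦ r·q(r) integrable on (0,a). Define Q : [0,∞) → ℝ by Q(x) = (a²/c²) e^{2x/c} (q(a e^{x/c}) − k²). Then Q is integrable on (0,∞) and ∫₀^∞ |Q(x)| dx ≤ (1/|c|) ∫₀^a r |q(r)| dr + a²k²/(2|c|). -/
open MeasureTheory Real

theorem hasDerivAt_const_mul_exp_div (a c x : ℝ) :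
    HasDerivAt (fun x => a * exp (x / c)) (a * exp (x / c) / c) x :=
  ((((hasDerivAt_id x).div_const c).exp).const_mul a).congr_deriv (by simp only [id]; ring)

theorem injective_const_mul_exp_div {a c : ℝ} (ha : a ≠ 0) (hc : c ≠ 0) :
    Function.Injective (fun x => a * exp (x / c)) := by
  intro x y hxy
  exact (div_left_inj' hc).1 (exp_injective (mul_left_cancel₀ ha hxy))

theorem image_const_mul_exp_div_Ioi {a c : ℝ} (ha : 0 < a) (hc : c < 0) :
    (fun x => a * exp (x / c)) '' Set.Ioi 0 = Set.Ioo 0 a := by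
  ext r
  constructor
  · rintro ⟨x, hx, rfl⟩
    have h : exp (x / c) < 1 := exp_lt_one_iff.2 (div_neg_of_pos_of_neg hx hc)
    exact ⟨by positivity, mul_lt_of_lt_one_right ha h⟩
  · rintro ⟨hr, hra⟩
    refine ⟨c * log (r / a),
      mul_pos_of_neg_of_neg hc (log_neg (div_pos hr ha) ((div_lt_one ha).2 hra)), ?_⟩
    simp only
    rw [mul_div_cancel_left₀ _ hc.ne, exp_log (div_pos hr ha), mul_div_cancel₀ _ ha.ne']

theorem integral_Ioo_id {a : ℝ} (ha : 0 ≤ a) : ∫ r in Set.Ioo 0 a, r = a ^ 2 / 2 := by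
  rw [← integral_Ioc_eq_integral_Ioo, ← intervalIntegral.integral_of_le ha, integral_id]
  ring

/-- If `q` is a compactly supported potential with `r q(r) ∈ L¹(0,a)`, then the
auxiliary potential `Q(x) = (a²/c²) e^{2x/c} (q(a e^{x/c}) - k²)` obtained from
the Liouville transformation is integrable on `(0,∞)` with
`∫₀^∞ |Q| ≤ (1/|c|) ∫₀^a r|q(r)| dr + a²k²/(2|c|)`. -/
theorem auxiliary_potential_L1
    (a c k : ℝ) (ha : 0 < a) (hc : c < 0)
    (q : ℝ → ℝ) (hq : Measurable q)
    (hsupp : ∀ r : ℝ, a ≤ r → q r = 0)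
    (hL1 : IntegrableOn (fun r => r * q r) (Set.Ioo 0 a))
    (Q : ℝ → ℝ)
    (hQ : ∀ x : ℝ, Q x =
      a ^ 2 / c ^ 2 * Real.exp (2 * x / c) * (q (a * Real.exp (x / c)) - k ^ 2)) :
    IntegrableOn Q (Set.Ioi 0) ∧
      ∫ x in Set.Ioi (0:ℝ), |Q x| ≤
        (1 / |c|) * (∫ r in Set.Ioo (0:ℝ) a, r * |q r|) + a ^ 2 * k ^ 2 / (2 * |c|) := by
  have hderiv : ∀ x ∈ Set.Ioi (0 : ℝ), HasDerivWithinAt (fun x => a * exp (x / c))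
      (a * exp (x / c) / c) (Set.Ioi 0) x :=
    fun x _ => (hasDerivAt_const_mul_exp_div a c x).hasDerivWithinAt
  have hinj : Set.InjOn (fun x => a * exp (x / c)) (Set.Ioi 0) :=
    (injective_const_mul_exp_div ha.ne' hc.ne).injOn
  have himage := image_const_mul_exp_div_Ioi ha hc
  set g : ℝ → ℝ := fun r => 1 / |c| * (r * (q r - k ^ 2)) with hg
  have hQg : ∀ x, |a * exp (x / c) / c| • g (a * exp (x / c)) = Q x := by
    intro x
    have hexp : exp (2 * x / c) = exp (x / c) ^ 2 := by
      rw [← exp_nat_mul]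
      congr 1
      push_cast
      ring
    rw [hQ, hexp, abs_div, abs_of_pos (by positivity : 0 < a * exp (x / c)), hg, smul_eq_mul,
      ← sq_abs c]
    ring
  have hid : IntegrableOn (fun r : ℝ => r) (Set.Ioo 0 a) :=
    continuous_id.continuousOn.integrableOn_Icc.mono_set Set.Ioo_subset_Icc_self
  have hgint : IntegrableOn g (Set.Ioo 0 a) := by
    refine IntegrableOn.congr_fun (((hL1.sub (hid.mul_const (k ^ 2))).const_mul (1 / |c|)))
      (fun r _ => ?_) measurableSet_Ioo
    simp only [hg, Pi.sub_apply]
    ring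
  constructor
  · rw [← himage, integrableOn_image_iff_integrableOn_abs_deriv_smul measurableSet_Ioi hderiv
      hinj] at hgint
    simpa only [hQg] using hgint
  · have hcov : ∫ x in Set.Ioi (0 : ℝ), |Q x| = ∫ r in Set.Ioo 0 a, |g r| := by
      rw [← himage, integral_image_eq_integral_abs_deriv_smul measurableSet_Ioi hderiv hinj]
      refine integral_congr_ae (.of_forall fun x => ?_)
      simp only [← hQg x, smul_eq_mul, abs_mul, abs_abs]
    have habs : IntegrableOn (fun r => r * |q r|) (Set.Ioo 0 a) := by
      refine IntegrableOn.congr_fun hL1.abs (fun r hr => ?_) measurableSet_Ioo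
      simp only [abs_mul, abs_of_pos hr.1]
    calc ∫ x in Set.Ioi (0 : ℝ), |Q x| = ∫ r in Set.Ioo 0 a, |g r| := hcov
      _ ≤ ∫ r in Set.Ioo 0 a, (1 / |c| * (r * |q r|) + 1 / |c| * k ^ 2 * r) := by
        refine setIntegral_mono_on hgint.abs
          ((habs.const_mul _).add (hid.const_mul _)) measurableSet_Ioo fun r hr => ?_
        have hr0 : 0 ≤ r := hr.1.le
        have hsub : |q r - k ^ 2| ≤ |q r| + k ^ 2 :=
          (abs_sub _ _).trans_eq (by rw [abs_of_nonneg (sq_nonneg k)])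
        calc |g r| = 1 / |c| * (r * |q r - k ^ 2|) := by
              simp only [hg, abs_mul, abs_of_nonneg hr0, abs_div, abs_one, abs_abs]
          _ ≤ 1 / |c| * (r * (|q r| + k ^ 2)) := by gcongr
          _ = _ := by ring
      _ = _ := by
        rw [integral_add (habs.const_mul _) (hid.const_mul _), integral_const_mul,
          integral_const_mul, integral_Ioo_id ha.le]
        ring
end

section
/- Let n ≥ 1 and let x₁,…,xₙ and y₁,…,yₙ be elements of a field such that the xᵢ are pairwise distinct, the yⱼ are pairwise distinct, and xᵢ + yⱼ ≠ 0 for all i, j. Let A be the n×n matrix with entries A_{ij} = 1/(xᵢ + yⱼ). Then A is invertible and its inverse B has entries B_{ij} = (x_j + y_i) · ∏_{m ≠ i} ((x_j + y_m)/(y_m − y_i)) · ∏_{m ≠ j} ((x_m + y_i)/(x_m − x_j)). -/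
open Finset Matrix

/-- Evaluating the Lagrange interpolant of a polynomial of degree less than the number of nodes
recovers the polynomial. -/
theorem Lagrange.sum_eval_mul_eval_basis {F ι : Type*} [Field F] [DecidableEq ι] {s : Finset ι}
    {v : ι → F} (hvs : Set.InjOn v s) {p : Polynomial F} (hp : p.degree < #s) (t : F) :
    ∑ j ∈ s, p.eval (v j) * (Lagrange.basis s v j).eval t = p.eval t := by
  conv_rhs => rw [Lagrange.eq_interpolate hvs hp, Lagrange.interpolate_apply]
  simp [Polynomial.eval_finsetSum]

theorem Lagrange.eval_neg_basis {F ι : Type*} [Field F] [DecidableEq ι] (s : Finset ι)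
    (v : ι → F) (j : ι) (t : F) :
    (Lagrange.basis s v j).eval (-t) = ∏ m ∈ s.erase j, (v m + t) / (v m - v j) := by
  rw [Lagrange.basis, Polynomial.eval_prod]
  refine Finset.prod_congr rfl fun m _ => ?_
  rw [Lagrange.basisDivisor, ← neg_sub (v m) (v j), inv_neg]
  simp only [Polynomial.eval_mul, Polynomial.eval_C, Polynomial.eval_sub, Polynomial.eval_X]
  ring

/-- Explicit inverse of a Cauchy matrix: if the `xᵢ` are pairwise distinct, the
`yⱼ` are pairwise distinct and `xᵢ + yⱼ ≠ 0` for all `i, j`, then the matrix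
`A = [1/(xᵢ + yⱼ)]` is invertible with inverse
`B_{ij} = (x_j + y_i) ∏_{m≠i} (x_j + y_m)/(y_m - y_i) ∏_{m≠j} (x_m + y_i)/(x_m - x_j)`. -/
theorem cauchy_matrix_inverse
    {K : Type*} [Field K] (n : ℕ) (hn : 1 ≤ n)
    (x y : Fin n → K)
    (hx : Function.Injective x) (hy : Function.Injective y)
    (hxy : ∀ i j, x i + y j ≠ 0)
    (A B : Matrix (Fin n) (Fin n) K)
    (hA : ∀ i j, A i j = (x i + y j)⁻¹)
    (hB : ∀ i j, B i j =
      (x j + y i) *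
        (∏ m ∈ Finset.univ.erase i, (x j + y m) / (y m - y i)) *
        (∏ m ∈ Finset.univ.erase j, (x m + y i) / (x m - x j))) :
    IsUnit A ∧ A⁻¹ = B := by
  have hBA : B * A = 1 := by
    ext i k
    set q : Polynomial K := Lagrange.nodal (univ.erase k) (fun m => -y m) with hq
    have hdeg : q.degree < #(univ : Finset (Fin n)) := by
      rw [hq, Lagrange.degree_nodal]
      exact_mod_cast Finset.card_erase_lt_of_mem (mem_univ k)
    have hqe (t : K) : q.eval t = ∏ m ∈ univ.erase k, (t + y m) := by
      simp [hq, Lagrange.eval_nodal]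
    have hterm (j : Fin n) : B i j * A j k = (∏ m ∈ univ.erase i, (y m - y i))⁻¹ *
        (q.eval (x j) * (Lagrange.basis univ x j).eval (-y i)) := by
      have hprod : (x j + y i) * ∏ m ∈ univ.erase i, (x j + y m) =
          (x j + y k) * ∏ m ∈ univ.erase k, (x j + y m) := by
        rw [mul_prod_erase _ (fun m => x j + y m) (mem_univ i),
          mul_prod_erase _ (fun m => x j + y m) (mem_univ k)]
      rw [hB, hA, Lagrange.eval_neg_basis, hqe, prod_div_distrib, div_eq_mul_inv, ← mul_assoc,
        hprod]
      field_simp [hxy j k]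
    simp_rw [Matrix.mul_apply, hterm]
    rw [← mul_sum, Lagrange.sum_eval_mul_eval_basis hx.injOn hdeg, hqe]
    rcases eq_or_ne i k with rfl | hik
    · have hne : ∏ m ∈ univ.erase i, (y m - y i) ≠ 0 :=
        prod_ne_zero_iff.2 fun m hm => sub_ne_zero.2 (hy.ne (ne_of_mem_erase hm))
      simp only [neg_add_eq_sub, Matrix.one_apply_eq]
      exact inv_mul_cancel₀ hne
    · rw [Matrix.one_apply_ne hik,
        prod_eq_zero (mem_erase.2 ⟨hik, mem_univ i⟩) (neg_add_cancel (y i)), mul_zero]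
  exact ⟨IsUnit.of_mul_eq_one_right B hBA, Matrix.inv_eq_left_inv hBA⟩
end

section
/- Let c < 0, let N be a natural number, and let μ₀, μ₁, …, μ_{N+1} be real numbers. For each t > 0 with t ≠ (l + 1/2)/|c| for every l = 0, 1, …, N+1, the linear system (−c)·b/(2((l + 1/2) + c t)) + ∑_{n=0}^{N} c_n · (−c)/(−cn + l + 1/2) = μ_l, for l = 0, 1, …, N+1, in the N+2 unknowns b, c₀, …, c_N, has a unique solution (b(t), c₀(t), …, c_N(t)), and there exist real constants α and β, not depending on t, such that b(t)/2 + ∑_{n=0}^{N} c_n(t) = α t + β for every such admissible t. -/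
open Finset
open Polynomial (eval eval_zero eval_sub degree_sub_lt_left)

/-- A Cauchy system with zero right-hand side has only the zero solution. -/
theorem cauchy_system_eq_zero {ι F : Type*} [Fintype ι] [DecidableEq ι] [Field F] {x y d : ι → F}
    (hx : Function.Injective x) (hy : Function.Injective y) (hxy : ∀ l j, x l + y j ≠ 0)
    (h : ∀ l, ∑ j, d j * (x l + y j)⁻¹ = 0) : d = 0 := by
  have hv : Set.InjOn (fun j => -y j) (univ : Finset ι) :=
    (neg_injective.comp hy).injOn
  have hw : ∀ j, Lagrange.nodalWeight univ (fun j => -y j) j ≠ 0 := fun j =>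
    Lagrange.nodalWeight_ne_zero hv (mem_univ j)
  set r : ι → F := fun j => d j / Lagrange.nodalWeight univ (fun j => -y j) j with hr
  have hp : Lagrange.interpolate univ (fun j => -y j) r = 0 := by
    refine Polynomial.eq_zero_of_degree_lt_of_eval_index_eq_zero univ hx.injOn
      (Lagrange.degree_interpolate_lt r hv) fun l _ => ?_
    rw [Lagrange.eval_interpolate_not_at_node r fun j _ hj => hxy l j (by rw [hj]; ring)]
    rw [← mul_zero (eval (x l) (Lagrange.nodal univ fun j => -y j)), ← h l]
    congr 1
    refine sum_congr rfl fun j _ => ?_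
    have := hw j
    simp only [hr, sub_neg_eq_add]
    field_simp
  funext j
  have hj := Lagrange.eval_interpolate_at_node r hv (mem_univ j)
  rw [hp, eval_zero] at hj
  exact (div_eq_zero_iff.mp hj.symm).resolve_right (hw j)

/-- A Cauchy system has a unique solution. -/
theorem cauchy_system_existsUnique {ι F : Type*} [Fintype ι] [DecidableEq ι] [Field F]
    {x y : ι → F} (hx : Function.Injective x) (hy : Function.Injective y)
    (hxy : ∀ l j, x l + y j ≠ 0) (μ : ι → F) :
    ∃! d : ι → F, ∀ l, ∑ j, d j * (x l + y j)⁻¹ = μ l := by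
  let A : Matrix ι ι F := Matrix.of fun l j => (x l + y j)⁻¹
  have hA : ∀ d l, A.mulVecLin d l = ∑ j, d j * (x l + y j)⁻¹ := fun d l =>
    sum_congr rfl fun j _ => mul_comm _ _
  have hinj : Function.Injective A.mulVecLin := by
    refine (injective_iff_map_eq_zero _).mpr fun d hd => ?_
    refine cauchy_system_eq_zero hx hy hxy fun l => ?_
    rw [← hA, hd, Pi.zero_apply]
  obtain ⟨d, hd⟩ := LinearMap.injective_iff_surjective.mp hinj μ
  refine ⟨d, fun l => by rw [← hA, hd], fun e he => hinj ?_⟩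
  rw [hd]
  exact funext fun l => (hA e l).trans (he l)

/-- The row vector whose product with a Cauchy matrix is the all-ones row vector. -/
theorem cauchy_sum_nodalWeight_mul {ι F : Type*} [Fintype ι] [DecidableEq ι] [Field F]
    {x y : ι → F} (hx : Function.Injective x) (hxy : ∀ l j, x l + y j ≠ 0) (j : ι) :
    ∑ l, Lagrange.nodalWeight univ (fun l => -x l) l * -(∏ i, (-x l - y i)) *
      (x l + y j)⁻¹ = 1 := by
  have hv : Set.InjOn (fun l => -x l) (univ : Finset ι) := (neg_injective.comp hx).injOn
  set P := Lagrange.nodal univ (fun l => -x l) with hP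
  set Q := Lagrange.nodal univ y with hQ
  have hdeg : (P - Q).degree < #(univ : Finset ι) := by
    rw [← Lagrange.degree_nodal (s := univ) (v := fun l => -x l)]
    refine degree_sub_lt_left ?_ Lagrange.nodal_ne_zero ?_
    · rw [hP, hQ, Lagrange.degree_nodal, Lagrange.degree_nodal]
    · rw [Lagrange.nodal_monic.leadingCoeff, Lagrange.nodal_monic.leadingCoeff]
  have hint := congrArg (eval (y j)) (Lagrange.eq_interpolate hv hdeg)
  rw [Lagrange.eval_interpolate_not_at_node _
    fun l _ hl => hxy l j (by rw [hl]; ring), eval_sub, hQ,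
    Lagrange.eval_nodal_at_node (mem_univ j), sub_zero] at hint
  have hP0 : eval (y j) P ≠ 0 :=
    Lagrange.eval_nodal_not_at_node fun l _ hl => hxy l j (by rw [hl]; ring)
  rw [← mul_right_inj' hP0, mul_one]
  refine Eq.trans ?_ hint.symm
  congr 1
  refine sum_congr rfl fun l _ => ?_
  rw [eval_sub, hP, Lagrange.eval_nodal_at_node (v := fun l => -x l) (mem_univ l),
    Lagrange.eval_nodal, zero_sub, sub_neg_eq_add, add_comm (y j)]
  ring

/-- The sum of the coefficients of a solution of a Cauchy system. -/
theorem cauchy_system_sum {ι F : Type*} [Fintype ι] [DecidableEq ι] [Field F]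
    {x y d μ : ι → F} (hx : Function.Injective x) (hxy : ∀ l j, x l + y j ≠ 0)
    (h : ∀ l, ∑ j, d j * (x l + y j)⁻¹ = μ l) :
    ∑ j, d j =
      ∑ l, Lagrange.nodalWeight univ (fun l => -x l) l * -(∏ i, (-x l - y i)) * μ l := by
  simp_rw [← h, mul_sum]
  rw [sum_comm]
  refine sum_congr rfl fun j _ => ?_
  have h1 := congrArg (d j * ·) (cauchy_sum_nodalWeight_mul hx hxy j)
  simp only [mul_one, mul_sum] at h1
  exact h1.symm.trans (sum_congr rfl fun l _ => by ring)

/-- In the one-bound-state case, for every admissible parameter `t > 0`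
(i.e. `t ≠ (l+1/2)/|c|` for all `l = 0,…,N+1`) the linear system
`(-c)b/(2((l+1/2) + ct)) + ∑_{n=0}^N c_n (-c)/(-cn + l + 1/2) = μ_l`,
`l = 0,…,N+1`, in the unknowns `(b, c₀,…,c_N)` has a unique solution, and the
sum `b/2 + ∑_n c_n` of the solution is an affine function `αt + β` of `t`
with `α, β` independent of `t`. -/
theorem one_bound_state_system_affine_sum
    (c : ℝ) (hc : c < 0) (N : ℕ) (μ : Fin (N + 2) → ℝ) :
    ∃ α β : ℝ, ∀ t : ℝ, 0 < t →
      (∀ l : Fin (N + 2), t ≠ ((l.val : ℝ) + 1/2) / |c|) →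
      (∃! v : ℝ × (Fin (N + 1) → ℝ),
        ∀ l : Fin (N + 2),
          (-c) * v.1 / (2 * (((l.val : ℝ) + 1/2) + c * t)) +
            ∑ n : Fin (N + 1),
              v.2 n * (-c) / (-c * (n.val : ℝ) + (l.val : ℝ) + 1/2) = μ l) ∧
      (∀ v : ℝ × (Fin (N + 1) → ℝ),
        (∀ l : Fin (N + 2),
          (-c) * v.1 / (2 * (((l.val : ℝ) + 1/2) + c * t)) +
            ∑ n : Fin (N + 1),
              v.2 n * (-c) / (-c * (n.val : ℝ) + (l.val : ℝ) + 1/2) = μ l) →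
        v.1 / 2 + ∑ n : Fin (N + 1), v.2 n = α * t + β) := by
  set x : Fin (N + 2) → ℝ := fun l => (l.val : ℝ) + 1 / 2 with hxdef
  have hx : Function.Injective x := fun a b hab => by
    simpa [hxdef, Fin.ext_iff] using hab
  set ω := Lagrange.nodalWeight univ (fun l => -x l)
  set R : Fin (N + 2) → ℝ := fun l => ∏ n : Fin (N + 1), (-x l - -c * (n.val : ℝ))
  refine ⟨∑ l, ω l * R l * (μ l / -c) * c, ∑ l, ω l * R l * (μ l / -c) * x l,
    fun t ht hadm => ?_⟩
  set y : Fin (N + 2) → ℝ := Fin.cons (c * t) fun n : Fin (N + 1) => -c * (n.val : ℝ)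
  have hct : c * t < 0 := mul_neg_of_neg_of_pos hc ht
  have hcn : ∀ n : Fin (N + 1), 0 ≤ -c * (n.val : ℝ) := fun n =>
    mul_nonneg (by linarith) n.val.cast_nonneg
  have hy : Function.Injective y := by
    refine Fin.cons_injective_iff.mpr ⟨?_, fun a b hab => ?_⟩
    · rintro ⟨n, hn⟩
      have := hcn n
      simp only at hn
      linarith
    · simpa [Fin.ext_iff, hc.ne] using hab
  have hxy : ∀ l j, x l + y j ≠ 0 := by
    intro l j
    have hl : (0 : ℝ) ≤ l.val := l.val.cast_nonneg
    refine Fin.cases ?_ (fun n => ?_) j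
    · intro h
      refine hadm l ?_
      simp only [hxdef, y, Fin.cons_zero] at h
      rw [abs_of_neg hc, eq_div_iff (by linarith)]
      linarith
    · have := hcn n
      simp only [hxdef, y, Fin.cons_succ]
      linarith
  have hsys : ∀ v : ℝ × (Fin (N + 1) → ℝ),
      (∀ l : Fin (N + 2),
        (-c) * v.1 / (2 * (((l.val : ℝ) + 1/2) + c * t)) +
          ∑ n : Fin (N + 1),
            v.2 n * (-c) / (-c * (n.val : ℝ) + (l.val : ℝ) + 1/2) = μ l) ↔
      ∀ l, ∑ j, (Fin.cons (v.1 / 2) v.2 : Fin (N + 2) → ℝ) j * (x l + y j)⁻¹ = μ l / -c := by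
    intro v
    refine forall_congr' fun l => ?_
    rw [eq_div_iff (neg_ne_zero.mpr hc.ne), sum_mul, Fin.sum_univ_succ (n := N + 1)]
    simp only [Fin.cons_zero, Fin.cons_succ, y, hxdef]
    refine Eq.congr (congrArg₂ _ ?_ (sum_congr rfl fun n _ => ?_)) rfl
    · rw [div_eq_mul_inv, mul_inv]
      ring
    · rw [div_eq_mul_inv, add_assoc, add_comm (-c * (n.val : ℝ))]
      ring
  simp only [hsys]
  constructor
  · obtain ⟨d, hd, huniq⟩ := cauchy_system_existsUnique hx hy hxy fun l => μ l / -c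
    refine ⟨(2 * d 0, Fin.tail d), ?_, fun v hv => ?_⟩
    · simpa [Fin.cons_self_tail] using hd
    · have hvd := huniq _ hv
      subst hvd
      ext <;> simp [Fin.tail]
      ring
  · intro v hv
    have hsum := cauchy_system_sum hx hxy hv
    rw [Fin.sum_univ_succ] at hsum
    simp only [Fin.cons_zero, Fin.cons_succ] at hsum
    rw [hsum, sum_mul, ← sum_add_distrib]
    refine sum_congr rfl fun l _ => ?_
    rw [Fin.prod_univ_succ]
    simp only [y, Fin.cons_zero, Fin.cons_succ, R, ω]
    ring
end
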